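/- Fix an integer p ≥ 0 and let m_{2p}(N) = ∫_ℝ x^{2p}·ρ_N(x) dx be the even GUE moments, and C_p = (2p)!/(p!·(p+1)!) the Catalan number. Then, as N → ∞ through the positive integers, m_{2p}(N)/(C_p·N^{p+1}) = 1 + (1/12)·(p+1)·p·(p−1)·N^{−2} + (1/1440)·(p+1)·p·(p−1)·(p−2)·(p−3)·(5p−2)·N^{−4} + (1/362880)·(p+1)·p·(p−1)·(p−2)·(p−3)·(p−4)·(p−5)·(35p²−77p+12)·N^{−6} + O(N^{−8}). -/

import Mathlib

open Nat MeasureTheory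

/-- The orthonormal Hermite functions' polynomial part:
`p_n(x) = He_n(x)/√(√(2π)·n!)`, orthonormal for the weight `e^{-x²/2}` on `ℝ`. -/
noncomputable def pOrtho (n : ℕ) (x : ℝ) : ℝ :=
  Polynomial.aeval x (Polynomial.hermite n) /
    Real.sqrt (Real.sqrt (2 * Real.pi) * (n ! : ℝ))

/-- The (unscaled) GUE eigenvalue density
`ρ_N(x) = √N · e^{-x²/2} · (p_N'(x)p_{N-1}(x) − p_N(x)p_{N-1}'(x))`. -/
noncomputable def gueDensity (N : ℕ) (x : ℝ) : ℝ :=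
  Real.sqrt N * Real.exp (-x ^ 2 / 2) *
    (deriv (pOrtho N) x * pOrtho (N - 1) x - pOrtho N x * deriv (pOrtho (N - 1)) x)

/-- The even moments `m_{2p} = ∫_ℝ x^{2p} ρ_N(x) dx` of the unscaled GUE
eigenvalue density. -/
noncomputable def gueMoment (N p : ℕ) : ℝ :=
  ∫ x : ℝ, x ^ (2 * p) * gueDensity N x


open Asymptotics Filter

open Polynomial in
/-- Every polynomial is integrable against the weight `e^{-x²/2}`. -/
theorem integrable_eval_mul_gaussian (P : ℝ[X]) :
    Integrable fun x : ℝ => P.eval x * Real.exp (-x ^ 2 / 2) := by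
  induction P using Polynomial.induction_on' with
  | add P Q hP hQ =>
    simp only [eval_add, add_mul]
    exact hP.add hQ
  | monomial n a =>
    have h := (integrable_rpow_mul_exp_neg_mul_sq (b := 1 / 2) (by norm_num)
      (s := (n : ℝ)) (by have := n.cast_nonneg (α := ℝ); linarith)).const_mul a
    refine h.congr (Eventually.of_forall fun x => ?_)
    simp only [eval_monomial, Real.rpow_natCast]
    rw [show -x ^ 2 / 2 = -(1 / 2) * x ^ 2 by ring]
    ring

open Polynomial in
/-- Integration of polynomials against the weight `e^{-x²/2}`. -/
noncomputable def gaussianFunctional : ℝ[X] →ₗ[ℝ] ℝ where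
  toFun P := ∫ x : ℝ, P.eval x * Real.exp (-x ^ 2 / 2)
  map_add' P Q := by
    simp only [eval_add, add_mul]
    exact integral_add (integrable_eval_mul_gaussian P) (integrable_eval_mul_gaussian Q)
  map_smul' c P := by
    simp only [eval_smul, smul_eq_mul, mul_assoc, RingHom.id_apply]
    exact integral_const_mul _ _

open Polynomial in
theorem gaussianFunctional_apply (P : ℝ[X]) :
    gaussianFunctional P = ∫ x : ℝ, P.eval x * Real.exp (-x ^ 2 / 2) := rfl

open Polynomial in
theorem gaussianFunctional_one : gaussianFunctional 1 = Real.sqrt (2 * Real.pi) := by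
  have h := integral_gaussian (1 / 2)
  rw [show Real.pi / (1 / 2) = 2 * Real.pi by ring] at h
  rw [gaussianFunctional_apply, ← h]
  congr 1 with x
  rw [eval_one, one_mul]
  congr 1
  ring

open Polynomial in
theorem gaussianFunctional_derivative_sub_X_mul (P : ℝ[X]) :
    gaussianFunctional (derivative P - X * P) = 0 := by
  rw [gaussianFunctional_apply]
  refine integral_eq_zero_of_hasDerivAt_of_integrable
    (f := fun x => P.eval x * Real.exp (-x ^ 2 / 2)) (fun x => ?_)
    (integrable_eval_mul_gaussian _) (integrable_eval_mul_gaussian _)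
  have h2 : HasDerivAt (fun x : ℝ => -x ^ 2 / 2) (-x) x := by
    refine (((hasDerivAt_pow 2 x).neg).div_const 2).congr_deriv ?_
    norm_num
    ring
  refine ((P.hasDerivAt x).mul h2.exp).congr_deriv ?_
  simp only [eval_sub, eval_mul, eval_X]
  ring

open Polynomial in
/-- Integration by parts for `gaussianFunctional`. -/
theorem gaussianFunctional_mul_derivative_sub (P R : ℝ[X]) :
    gaussianFunctional (P * (derivative R - X * R)) =
      -gaussianFunctional (derivative P * R) := by
  have h := gaussianFunctional_derivative_sub_X_mul (P * R)
  rw [show derivative (P * R) - X * (P * R) =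
      derivative P * R + P * (derivative R - X * R) by rw [derivative_mul]; ring, map_add] at h
  linarith

open Polynomial in
/-- The probabilists' Hermite polynomials with real coefficients. -/
noncomputable def realHermite (n : ℕ) : ℝ[X] := (hermite n).map (Int.castRingHom ℝ)

open Polynomial in
theorem realHermite_succ (n : ℕ) :
    realHermite (n + 1) = X * realHermite n - derivative (realHermite n) := by
  simp [realHermite, hermite_succ, derivative_map]

open Polynomial in
theorem derivative_realHermite_succ (n : ℕ) :
    derivative (realHermite (n + 1)) = C ((n : ℝ) + 1) * realHermite n := by
  induction n with
  | zero => simp [realHermite]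
  | succ n ih =>
    rw [realHermite_succ (n + 1), derivative_sub, derivative_mul, derivative_X, ih,
      derivative_C_mul, realHermite_succ n]
    push_cast
    simp only [map_add, map_one]
    ring

open Polynomial in
theorem gaussianFunctional_realHermite_mul (n : ℕ) (P : ℝ[X]) :
    gaussianFunctional (realHermite n * P) = gaussianFunctional (derivative^[n] P) := by
  induction n generalizing P with
  | zero => simp [realHermite]
  | succ n ih =>
    rw [Function.iterate_succ_apply, ← ih, realHermite_succ,
      show (X * realHermite n - derivative (realHermite n)) * P =
        -(P * (derivative (realHermite n) - X * realHermite n)) by ring, map_neg,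
      gaussianFunctional_mul_derivative_sub, neg_neg, mul_comm]

open Polynomial in
theorem natDegree_realHermite (n : ℕ) : (realHermite n).natDegree = n := by
  rw [realHermite, (hermite_monic n).natDegree_map, natDegree_hermite]

open Polynomial in
theorem gaussianFunctional_realHermite_sq (n : ℕ) :
    gaussianFunctional (realHermite n * realHermite n) = n ! * Real.sqrt (2 * Real.pi) := by
  induction n with
  | zero => simp [realHermite, gaussianFunctional_one]
  | succ n ih =>
    rw [gaussianFunctional_realHermite_mul, Function.iterate_succ_apply,
      ← gaussianFunctional_realHermite_mul, derivative_realHermite_succ,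
      show realHermite n * (C ((n : ℝ) + 1) * realHermite n) =
        ((n : ℝ) + 1) • (realHermite n * realHermite n) by rw [smul_eq_C_mul]; ring,
      map_smul, ih, smul_eq_mul, Nat.factorial_succ]
    push_cast
    ring

open Polynomial in
/-- The Wronskian of consecutive Hermite polynomials: the polynomial part of the GUE density,
up to a constant factor. -/
noncomputable def hermiteWronskian (n : ℕ) : ℝ[X] :=
  derivative (realHermite (n + 1)) * realHermite n -
    realHermite (n + 1) * derivative (realHermite n)

open Polynomial in
theorem gaussianFunctional_hermiteWronskian (n : ℕ) :
    gaussianFunctional (hermiteWronskian n) = (n + 1)! * Real.sqrt (2 * Real.pi) := by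
  rw [hermiteWronskian, map_sub, gaussianFunctional_realHermite_mul,
    iterate_derivative_eq_zero, map_zero, derivative_realHermite_succ, mul_assoc,
    ← smul_eq_C_mul, map_smul, gaussianFunctional_realHermite_sq, smul_eq_mul,
    Nat.factorial_succ]
  · push_cast
    ring
  · have := natDegree_derivative_le (realHermite n)
    rw [natDegree_realHermite] at this
    lia

open Polynomial in
/-- The third-order differential equation of the GUE density, tested against a polynomial. -/
theorem gaussianFunctional_loop_equation (n : ℕ) (P : ℝ[X]) :
    gaussianFunctional (derivative (derivative (derivative P)) * hermiteWronskian n) +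
      gaussianFunctional (derivative ((C (4 * ((n : ℝ) + 1)) - X ^ 2) * P) * hermiteWronskian n) =
      gaussianFunctional (X * P * hermiteWronskian n) := by
  have hA := derivative_realHermite_succ n
  have hB : derivative (realHermite n) = X * realHermite n - realHermite (n + 1) := by
    rw [realHermite_succ]; ring
  have hQ : hermiteWronskian n = C ((n : ℝ) + 1) * realHermite n ^ 2 -
      X * realHermite (n + 1) * realHermite n + realHermite (n + 1) ^ 2 := by
    rw [hermiteWronskian, hA, hB]; ring
  have h1 : derivative (hermiteWronskian n) - X * hermiteWronskian n =
      -(realHermite (n + 1) * realHermite n) := by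
    rw [hQ]
    simp only [derivative_add, derivative_sub, derivative_mul, derivative_sq, derivative_C,
      derivative_X, hA, hB, map_ofNat]
    ring
  have h2 : derivative (derivative (hermiteWronskian n) - X * hermiteWronskian n) -
      X * (derivative (hermiteWronskian n) - X * hermiteWronskian n) =
      realHermite (n + 1) ^ 2 - C ((n : ℝ) + 1) * realHermite n ^ 2 := by
    rw [h1]
    simp only [derivative_neg, derivative_mul, hA, hB]
    ring
  have e3 := gaussianFunctional_mul_derivative_sub P
    (derivative (derivative (hermiteWronskian n) - X * hermiteWronskian n) -
      X * (derivative (hermiteWronskian n) - X * hermiteWronskian n))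
  rw [gaussianFunctional_mul_derivative_sub (derivative P),
    gaussianFunctional_mul_derivative_sub (derivative (derivative P)), h2, neg_neg] at e3
  have e1 := gaussianFunctional_mul_derivative_sub ((C (4 * ((n : ℝ) + 1)) - X ^ 2) * P)
    (hermiteWronskian n)
  rw [h1] at e1
  have key : P * (derivative (realHermite (n + 1) ^ 2 - C ((n : ℝ) + 1) * realHermite n ^ 2) -
      X * (realHermite (n + 1) ^ 2 - C ((n : ℝ) + 1) * realHermite n ^ 2)) +
      (C (4 * ((n : ℝ) + 1)) - X ^ 2) * P * -(realHermite (n + 1) * realHermite n) +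
      X * P * hermiteWronskian n = 0 := by
    rw [hQ]
    simp only [derivative_sub, derivative_mul, derivative_sq, derivative_C, hA, hB, map_mul,
      map_ofNat]
    ring
  have h := congrArg gaussianFunctional key
  rw [map_add gaussianFunctional, map_add gaussianFunctional, map_zero] at h
  linarith

open Polynomial in
theorem pOrtho_eq (n : ℕ) :
    pOrtho n = fun x => (realHermite n).eval x /
      Real.sqrt (Real.sqrt (2 * Real.pi) * (n ! : ℝ)) := by
  funext x
  rw [pOrtho, realHermite, eval_map, aeval_def]
  rfl

open Polynomial in
theorem deriv_pOrtho (n : ℕ) (x : ℝ) :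
    deriv (pOrtho n) x = (derivative (realHermite n)).eval x /
      Real.sqrt (Real.sqrt (2 * Real.pi) * (n ! : ℝ)) := by
  rw [pOrtho_eq, deriv_div_const, Polynomial.deriv]

open Polynomial in
theorem gueDensity_succ (n : ℕ) (x : ℝ) :
    gueDensity (n + 1) x = (Real.sqrt (2 * Real.pi) * (n ! : ℝ))⁻¹ *
      ((hermiteWronskian n).eval x * Real.exp (-x ^ 2 / 2)) := by
  have hc : 0 < Real.sqrt (2 * Real.pi) * (n ! : ℝ) := by positivity
  have hs : Real.sqrt (Real.sqrt (2 * Real.pi) * ((n + 1)! : ℝ)) =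
      Real.sqrt ((n : ℝ) + 1) * Real.sqrt (Real.sqrt (2 * Real.pi) * (n ! : ℝ)) := by
    rw [← Real.sqrt_mul (by positivity), Nat.factorial_succ]
    congr 1
    push_cast
    ring
  have hN : 0 < Real.sqrt ((n : ℝ) + 1) := by positivity
  have hr : 0 < Real.sqrt (Real.sqrt (2 * Real.pi) * (n ! : ℝ)) := by positivity
  have hrr := Real.mul_self_sqrt hc.le
  rw [gueDensity, Nat.add_sub_cancel, deriv_pOrtho, deriv_pOrtho, pOrtho_eq, pOrtho_eq, hs,
    hermiteWronskian, eval_sub, eval_mul, eval_mul]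
  generalize Real.sqrt (Real.sqrt (2 * Real.pi) * (n ! : ℝ)) = r at *
  rw [← hrr]
  push_cast
  field_simp

open Polynomial in
theorem gueMoment_succ (n p : ℕ) :
    gueMoment (n + 1) p = (Real.sqrt (2 * Real.pi) * (n ! : ℝ))⁻¹ *
      gaussianFunctional (X ^ (2 * p) * hermiteWronskian n) := by
  rw [gueMoment, gaussianFunctional_apply, ← integral_const_mul]
  congr 1 with x
  rw [gueDensity_succ, eval_mul, eval_pow, eval_X]
  ring

theorem gueMoment_zero {N : ℕ} (hN : 0 < N) : gueMoment N 0 = N := by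
  obtain ⟨n, rfl⟩ := Nat.exists_eq_add_of_lt hN
  rw [zero_add, gueMoment_succ, mul_zero, pow_zero, one_mul, gaussianFunctional_hermiteWronskian,
    Nat.factorial_succ]
  push_cast
  field_simp

open Polynomial in
theorem gueMoment_one {N : ℕ} (hN : 0 < N) : gueMoment N 1 = (N : ℝ) ^ 2 := by
  have h0 := gueMoment_zero hN
  obtain ⟨n, rfl⟩ := Nat.exists_eq_add_of_lt hN
  rw [zero_add, gueMoment_succ] at *
  have h := gaussianFunctional_loop_equation n X
  rw [show derivative (derivative (derivative (X : ℝ[X]))) * hermiteWronskian n = 0 by simp,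
    show derivative ((C (4 * ((n : ℝ) + 1)) - X ^ 2) * X) * hermiteWronskian n =
      (4 * ((n : ℝ) + 1)) • (X ^ (2 * 0) * hermiteWronskian n) -
        (3 : ℝ) • (X ^ (2 * 1) * hermiteWronskian n) by
      simp only [smul_eq_C_mul, derivative_mul, derivative_sub, derivative_C, derivative_X_sq,
        derivative_X, map_ofNat]
      ring,
    show X * X * hermiteWronskian n = X ^ (2 * 1) * hermiteWronskian n by ring, map_zero,
    map_sub, map_smul, map_smul, smul_eq_mul, smul_eq_mul] at h
  push_cast at h0 ⊢
  linear_combination ((n : ℝ) + 1) * h0 -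
    (Real.sqrt (2 * Real.pi) * (n ! : ℝ))⁻¹ / 4 * h

open Polynomial in
/-- The Harer–Zagier recursion for the even GUE moments. -/
theorem gueMoment_add_two {N : ℕ} (hN : 0 < N) (k : ℕ) :
    (2 * (k : ℝ) + 6) * gueMoment N (k + 2) =
      4 * N * (2 * k + 3) * gueMoment N (k + 1) +
        (2 * k + 3) * (2 * k + 2) * (2 * k + 1) * gueMoment N k := by
  obtain ⟨n, rfl⟩ := Nat.exists_eq_add_of_lt hN
  simp only [zero_add, gueMoment_succ]
  have h := gaussianFunctional_loop_equation n (X ^ (2 * k + 3))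
  rw [show derivative (derivative (derivative (X ^ (2 * k + 3) : ℝ[X]))) * hermiteWronskian n =
      ((2 * (k : ℝ) + 3) * (2 * k + 2) * (2 * k + 1)) •
        (X ^ (2 * k) * hermiteWronskian n) by
      simp only [derivative_X_pow, derivative_C_mul, smul_eq_C_mul, Nat.add_sub_cancel,
        show 2 * k + 3 - 1 = 2 * k + 2 by lia, show 2 * k + 2 - 1 = 2 * k + 1 by lia]
      push_cast
      simp only [map_add, map_mul, map_ofNat, map_one]
      ring,
    show derivative ((C (4 * ((n : ℝ) + 1)) - X ^ 2) * X ^ (2 * k + 3)) * hermiteWronskian n =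
      (4 * ((n : ℝ) + 1) * (2 * k + 3)) • (X ^ (2 * (k + 1)) * hermiteWronskian n) -
        (2 * (k : ℝ) + 5) • (X ^ (2 * (k + 2)) * hermiteWronskian n) by
      simp only [derivative_X_pow, derivative_mul, derivative_sub, derivative_C, smul_eq_C_mul,
        show 2 * k + 3 - 1 = 2 * k + 2 by lia]
      push_cast
      simp only [map_add, map_mul, map_ofNat, map_one]
      ring,
    show X * X ^ (2 * k + 3) * hermiteWronskian n =
      X ^ (2 * (k + 2)) * hermiteWronskian n by ring,
    map_sub, map_smul, map_smul, map_smul, smul_eq_mul, smul_eq_mul, smul_eq_mul] at h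
  push_cast
  linear_combination -(Real.sqrt (2 * Real.pi) * (n ! : ℝ))⁻¹ * h

/-- The even GUE moments normalised by their leading large-`N` behaviour. -/
noncomputable def normalizedGueMoment (N p : ℕ) : ℝ :=
  gueMoment N p / (((2 * p)! : ℝ) / ((p ! : ℝ) * ((p + 1)! : ℝ)) * (N : ℝ) ^ (p + 1))

theorem normalizedGueMoment_add_two {N : ℕ} (hN : 0 < N) (k : ℕ) :
    normalizedGueMoment N (k + 2) = normalizedGueMoment N (k + 1) +
      ((k : ℝ) + 2) * (k + 1) / 4 * ((N : ℝ) ^ 2)⁻¹ * normalizedGueMoment N k := by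
  have hm : gueMoment N (k + 2) = (4 * N * (2 * k + 3) * gueMoment N (k + 1) +
        (2 * k + 3) * (2 * k + 2) * (2 * k + 1) * gueMoment N k) / (2 * (k : ℝ) + 6) := by
    rw [← gueMoment_add_two hN]
    field_simp
  have hN' : (N : ℝ) ≠ 0 := by positivity
  have h0 : ((2 * k)! : ℝ) ≠ 0 := by positivity
  have h1 : (k ! : ℝ) ≠ 0 := by positivity
  simp only [normalizedGueMoment, hm, show 2 * (k + 2) = 2 * k + 1 + 1 + 1 + 1 by ring,
    show 2 * (k + 1) = 2 * k + 1 + 1 by ring, show k + 2 = k + 1 + 1 by ring,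
    Nat.factorial_succ]
  push_cast
  have h2 : (2 * (k : ℝ) + 6) ≠ 0 := by positivity
  have h3 : (2 * (k : ℝ) + 1) ≠ 0 := by positivity
  have h4 : (2 * (k : ℝ) + 1 + 1) ≠ 0 := by positivity
  have h5 : (2 * (k : ℝ) + 1 + 1 + 1) ≠ 0 := by positivity
  have h6 : (2 * (k : ℝ) + 1 + 1 + 1 + 1) ≠ 0 := by positivity
  have h7 : ((k : ℝ) + 1) ≠ 0 := by positivity
  have h8 : ((k : ℝ) + 1 + 1) ≠ 0 := by positivity
  have h9 : ((k : ℝ) + 1 + 1 + 1) ≠ 0 := by positivity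
  field_simp
  ring

/-- Large-`N` asymptotic expansion of the even GUE moments:
`m_{2p}/(C_p N^{p+1}) = 1 + (p+1)p(p−1)/(12N²) + … + O(N^{−8})`, where
`C_p` is the `p`-th Catalan number. -/
theorem gueMoment_largeN (p : ℕ) :
    (fun N : ℕ =>
        gueMoment N p / (((2 * p)! : ℝ) / ((p ! : ℝ) * ((p + 1)! : ℝ)) * (N : ℝ) ^ (p + 1)) -
          (1 + (1 / 12) * ((p : ℝ) + 1) * (p : ℝ) * ((p : ℝ) - 1) * ((N : ℝ) ^ 2)⁻¹ +
            (1 / 1440) * ((p : ℝ) + 1) * (p : ℝ) * ((p : ℝ) - 1) * ((p : ℝ) - 2) *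
              ((p : ℝ) - 3) * (5 * (p : ℝ) - 2) * ((N : ℝ) ^ 4)⁻¹ +
            (1 / 362880) * ((p : ℝ) + 1) * (p : ℝ) * ((p : ℝ) - 1) * ((p : ℝ) - 2) *
              ((p : ℝ) - 3) * ((p : ℝ) - 4) * ((p : ℝ) - 5) *
              (35 * (p : ℝ) ^ 2 - 77 * (p : ℝ) + 12) * ((N : ℝ) ^ 6)⁻¹)) =O[atTop]
      fun N : ℕ => ((N : ℝ) ^ 8)⁻¹ := by
  change (fun N : ℕ => normalizedGueMoment N p - _) =O[atTop] _
  induction p using Nat.twoStepInduction with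
  | zero =>
    refine (isBigO_zero _ _).congr' ?_ EventuallyEq.rfl
    filter_upwards [eventually_gt_atTop 0] with N hN
    have hN' : (N : ℝ) ≠ 0 := by positivity
    simp [normalizedGueMoment, gueMoment_zero hN, hN']
  | one =>
    refine (isBigO_zero _ _).congr' ?_ EventuallyEq.rfl
    filter_upwards [eventually_gt_atTop 0] with N hN
    have hN' : (N : ℝ) ≠ 0 := by positivity
    simp [normalizedGueMoment, gueMoment_one hN, hN']
  | more k ih0 ih1 =>
    have hinv : (fun N : ℕ => ((N : ℝ) ^ 2)⁻¹) =O[atTop] fun _ : ℕ => (1 : ℝ) := by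
      refine IsBigO.of_bound 1 (eventually_atTop.2 ⟨1, fun N hN => ?_⟩)
      have hN' : (1 : ℝ) ≤ N := by exact_mod_cast hN
      rw [norm_inv, norm_pow, Real.norm_of_nonneg (by positivity), norm_one, one_mul]
      exact inv_le_one_of_one_le₀ (one_le_pow₀ hN')
    have h0 := (hinv.mul ih0).const_mul_left (((k : ℝ) + 2) * (k + 1) / 4)
    have h2 := (isBigO_refl (fun N : ℕ => ((N : ℝ) ^ 8)⁻¹) atTop).const_mul_left
      (((k : ℝ) + 2) * (k + 1) / 4 * ((1 / 362880) * ((k : ℝ) + 1) * (k : ℝ) * ((k : ℝ) - 1) *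
        ((k : ℝ) - 2) * ((k : ℝ) - 3) * ((k : ℝ) - 4) * ((k : ℝ) - 5) *
        (35 * (k : ℝ) ^ 2 - 77 * (k : ℝ) + 12)))
    simp only [one_mul] at h0
    refine ((ih1.add h0).add h2).congr' ?_ EventuallyEq.rfl
    filter_upwards [eventually_gt_atTop 0] with N hN
    have hN' : (N : ℝ) ≠ 0 := by positivity
    rw [normalizedGueMoment_add_two hN]
    push_cast
    field_simp
    ring
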